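/- arXiv:1104.5133 — 2 statements merged into one kernel-verified Lean document; each statement's English description precedes it below -/
import Mathlib

section
/- Let P be a FASP program. Then any answer set A of P is a fixpoint of the immediate consequence operator Π_P, i.e. A(a) = sup { A(body(r)) | r ∈ P_a } for every atom a in the Herbrand base of P. -/
/-- A t-norm on `[0,1]`: an increasing (in each argument), commutative and associative
binary operator on `[0,1]` with neutral element `1`. -/
structure Tnorm where
  T : ℝ → ℝ → ℝ
  mem_Icc : ∀ x ∈ Set.Icc (0:ℝ) 1, ∀ y ∈ Set.Icc (0:ℝ) 1, T x y ∈ Set.Icc (0:ℝ) 1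
  mono : ∀ x ∈ Set.Icc (0:ℝ) 1, ∀ x' ∈ Set.Icc (0:ℝ) 1, ∀ y ∈ Set.Icc (0:ℝ) 1,
    ∀ y' ∈ Set.Icc (0:ℝ) 1, x ≤ x' → y ≤ y' → T x y ≤ T x' y'
  comm : ∀ x ∈ Set.Icc (0:ℝ) 1, ∀ y ∈ Set.Icc (0:ℝ) 1, T x y = T y x
  assoc : ∀ x ∈ Set.Icc (0:ℝ) 1, ∀ y ∈ Set.Icc (0:ℝ) 1, ∀ z ∈ Set.Icc (0:ℝ) 1,
    T (T x y) z = T x (T y z)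
  one_T : ∀ x ∈ Set.Icc (0:ℝ) 1, T 1 x = x

/-- Left continuity of a t-norm in each argument (on `[0,1]`). -/
def Tnorm.LeftContinuous (Tn : Tnorm) : Prop :=
  ∀ x ∈ Set.Icc (0:ℝ) 1, ∀ y ∈ Set.Icc (0:ℝ) 1,
    ContinuousWithinAt (fun t => Tn.T x t) (Set.Icc (0:ℝ) y) y ∧
    ContinuousWithinAt (fun t => Tn.T t y) (Set.Icc (0:ℝ) x) x

/-- The residual implicator of a t-norm: `I_T(x,y) = sup { λ ∈ [0,1] | T(x,λ) ≤ y }`. -/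
noncomputable def Tnorm.resid (Tn : Tnorm) (x y : ℝ) : ℝ :=
  sSup { l | l ∈ Set.Icc (0:ℝ) 1 ∧ Tn.T x l ≤ y }

/-- The n-ary extension of a t-norm: `T(b) = b`, `T(b₁,…,bₙ) = T(b₁, T(b₂,…,bₙ))`. -/
def Tnorm.listEval (Tn : Tnorm) : List ℝ → ℝ
  | [] => 1
  | [x] => x
  | x :: xs => Tn.T x (Tn.listEval xs)

/-- A negator: a decreasing `[0,1] → [0,1]` map with `N(0) = 1` and `N(1) = 0`. -/
structure Negator where
  N : ℝ → ℝ
  mem_Icc : ∀ x ∈ Set.Icc (0:ℝ) 1, N x ∈ Set.Icc (0:ℝ) 1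
  anti : ∀ x ∈ Set.Icc (0:ℝ) 1, ∀ y ∈ Set.Icc (0:ℝ) 1, x ≤ y → N y ≤ N x
  N_zero : N 0 = 1
  N_one : N 1 = 0

/-- A body element of a FASP rule: an atom, a constant from `[0,1]`, or a negated atom. -/
inductive Lit (α : Type*) where
  | pos : α → Lit α
  | const : ℝ → Lit α
  | neg : Negator → α → Lit α

/-- A FASP rule `a ← T(b₁,…,bₙ)`: a head (an atom or a constant in `[0,1]`), a body
(a list of extended literals, combined by the rule's t-norm). -/
structure Rule (α : Type*) where
  head : α ⊕ ℝ
  body : List (Lit α)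
  tnorm : Tnorm

/-- Well-formedness of a literal: constants must lie in `[0,1]`. -/
def Lit.WF {α : Type*} : Lit α → Prop
  | .const c => c ∈ Set.Icc (0:ℝ) 1
  | _ => True

/-- Well-formedness of a rule: nonempty body, constants in `[0,1]`, and a
left-continuous t-norm. -/
def Rule.WF {α : Type*} (r : Rule α) : Prop :=
  r.body ≠ [] ∧ (∀ l ∈ r.body, l.WF) ∧ r.tnorm.LeftContinuous ∧
    ∀ c : ℝ, r.head = Sum.inr c → c ∈ Set.Icc (0:ℝ) 1

/-- Well-formedness of a FASP program (a set of rules). -/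
def ProgramWF {α : Type*} (P : Set (Rule α)) : Prop := ∀ r ∈ P, r.WF

/-- An interpretation maps every atom to a value in `[0,1]`. -/
def IsInterp {α : Type*} (I : α → ℝ) : Prop := ∀ a, I a ∈ Set.Icc (0:ℝ) 1

/-- Evaluation of an extended literal: `I(c) = c`, `I(N(b)) = N(I(b))`. -/
def Lit.eval {α : Type*} (I : α → ℝ) : Lit α → ℝ
  | .pos a => I a
  | .const c => c
  | .neg n a => n.N (I a)

/-- Evaluation of a rule body: `I(body(r)) = T_r(I(b₁),…,I(bₙ))`. -/
def Rule.evalBody {α : Type*} (I : α → ℝ) (r : Rule α) : ℝ :=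
  r.tnorm.listEval (r.body.map (Lit.eval I))

/-- Evaluation of a rule head. -/
def evalHead {α : Type*} (I : α → ℝ) : α ⊕ ℝ → ℝ
  | .inl a => I a
  | .inr c => c

/-- The atoms occurring positively (non-negated) in the body of a rule. -/
def Rule.posbody {α : Type*} (r : Rule α) : Set α := { a | Lit.pos a ∈ r.body }

/-- The immediate consequence operator:
`Π_P(I)(a) = sup { I(body(r)) | r ∈ P_a }` (with `sup ∅ = 0`). -/
noncomputable def PiOp {α : Type*} (P : Set (Rule α)) (I : α → ℝ) : α → ℝ :=
  fun a => sSup { x | ∃ r ∈ P, r.head = Sum.inl a ∧ x = r.evalBody I }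

/-- `I` is a model of `P` iff `I(r) = I_r(I(body(r)), I(head(r))) = 1` for all `r ∈ P`. -/
def IsModel {α : Type*} (P : Set (Rule α)) (I : α → ℝ) : Prop :=
  ∀ r ∈ P, r.tnorm.resid (r.evalBody I) (evalHead I r.head) = 1

/-- The support of an interpretation: `supp(I) = { a | I(a) > 0 }`. -/
def supp {α : Type*} (I : α → ℝ) : Set α := { a | 0 < I a }

/-- `U` is unfounded w.r.t. `I`: for each `u ∈ U` and rule `r ∈ P_u`, either
`U ∩ posbody(r) ≠ ∅`, or `I(u) > I(body(r))`, or `I(body(r)) = 0`. -/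
def Unfounded {α : Type*} (P : Set (Rule α)) (I : α → ℝ) (U : Set α) : Prop :=
  ∀ u ∈ U, ∀ r ∈ P, r.head = Sum.inl u →
    (U ∩ r.posbody).Nonempty ∨ r.evalBody I < I u ∨ r.evalBody I = 0

/-- `I` is unfounded-free iff `supp(I) ∩ U = ∅` for every unfounded set `U`. -/
def UnfoundedFree {α : Type*} (P : Set (Rule α)) (I : α → ℝ) : Prop :=
  ∀ U : Set α, Unfounded P I U → supp I ∩ U = ∅

/-- An answer set of `P` is an unfounded-free model of `P`. -/
def IsAnswerSet {α : Type*} (P : Set (Rule α)) (I : α → ℝ) : Prop :=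
  IsModel P I ∧ UnfoundedFree P I

/-- The reduct of a literal w.r.t. `I`: every negated atom `N(b)` is replaced by the
constant `N(I(b))`. -/
def Lit.reduct {α : Type*} (I : α → ℝ) : Lit α → Lit α
  | .neg n a => .const (n.N (I a))
  | l => l

/-- The reduct of a rule w.r.t. `I`. -/
def Rule.reduct {α : Type*} (I : α → ℝ) (r : Rule α) : Rule α :=
  ⟨r.head, r.body.map (Lit.reduct I), r.tnorm⟩

/-- The reduct of a program: `P^I = { r^I | r ∈ P }`. -/
def reduct {α : Type*} (P : Set (Rule α)) (I : α → ℝ) : Set (Rule α) :=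
  (Rule.reduct I) '' P

/-- `F` is the least fixpoint of `Π_P` (among interpretations). -/
def IsLfp {α : Type*} (P : Set (Rule α)) (F : α → ℝ) : Prop :=
  IsInterp F ∧ PiOp P F = F ∧
    ∀ G : α → ℝ, IsInterp G → PiOp P G = G → ∀ a, F a ≤ G a

/-- `I` is a model of the completion `comp(P)`: for every atom `a`,
`I(a) = sup { I(body(r)) | r ∈ P_a }` (with `sup ∅ = 0`), and for every rule with a
constant head `c`, `I(body(r)) ≤ c`. -/
def ModelsComp {α : Type*} (P : Set (Rule α)) (I : α → ℝ) : Prop :=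
  (∀ a, I a = sSup { x | ∃ r ∈ P, r.head = Sum.inl a ∧ x = r.evalBody I }) ∧
  (∀ r ∈ P, ∀ c : ℝ, r.head = Sum.inr c → r.evalBody I ≤ c)

/-- Edge of the positive dependency graph of `P`: `(a,b)` iff some rule with head `a`
has `b` occurring positively in its body. -/
def depEdge {α : Type*} (P : Set (Rule α)) (a b : α) : Prop :=
  ∃ r ∈ P, r.head = Sum.inl a ∧ b ∈ r.posbody

/-- A loop of `P`: a nonempty set `L` of atoms such that any two elements of `L` are
joined by a path of positive length in the positive dependency graph all of whose
vertices lie in `L`. -/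
def IsLoop {α : Type*} (P : Set (Rule α)) (L : Set α) : Prop :=
  L.Nonempty ∧ ∀ a ∈ L, ∀ b ∈ L,
    Relation.TransGen (fun u v => depEdge P u v ∧ u ∈ L ∧ v ∈ L) a b

/-- `R⁻(P,L)`: the rules of `P` with head in `L` whose positive body is disjoint
from `L`. -/
def extRules {α : Type*} (P : Set (Rule α)) (L : Set α) : Set (Rule α) :=
  { r | r ∈ P ∧ (∃ a ∈ L, r.head = Sum.inl a) ∧ r.posbody ∩ L = ∅ }

/-- `I` satisfies the loop formula `LF(L,P)` iff
`max { I(l) | l ∈ L } ≤ max { I(body(r)) | r ∈ R⁻(P,L) }` (right-hand side `0` when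
`R⁻(P,L) = ∅`). -/
def SatLF {α : Type*} (P : Set (Rule α)) (L : Set α) (I : α → ℝ) : Prop :=
  sSup (I '' L) ≤ sSup { x | ∃ r ∈ extRules P L, x = r.evalBody I }

/-- A simple program: no rule body contains a negated atom. -/
def Simple {α : Type*} (P : Set (Rule α)) : Prop :=
  ∀ r ∈ P, ∀ l ∈ r.body, ∀ (n : Negator) (a : α), l ≠ Lit.neg n a

theorem Tnorm.listEval_mem_Icc (Tn : Tnorm) :
    ∀ xs : List ℝ, (∀ x ∈ xs, x ∈ Set.Icc (0:ℝ) 1) → Tn.listEval xs ∈ Set.Icc (0:ℝ) 1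
  | [], _ => ⟨zero_le_one, le_rfl⟩
  | [x], h => h x (by simp)
  | x :: y :: ys, h =>
    Tn.mem_Icc x (h x (by simp)) _
      (Tn.listEval_mem_Icc (y :: ys) fun z hz => h z (List.mem_cons_of_mem _ hz))

theorem Lit.eval_mem_Icc {α : Type*} {I : α → ℝ} (hI : IsInterp I) {l : Lit α} (hl : l.WF) :
    l.eval I ∈ Set.Icc (0:ℝ) 1 := by
  cases l with
  | pos a => exact hI a
  | const c => exact hl
  | neg n a => exact n.mem_Icc _ (hI a)

theorem Rule.evalBody_mem_Icc {α : Type*} {I : α → ℝ} (hI : IsInterp I) {r : Rule α}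
    (hr : r.WF) : r.evalBody I ∈ Set.Icc (0:ℝ) 1 := by
  refine r.tnorm.listEval_mem_Icc _ fun x hx => ?_
  obtain ⟨l, hl, rfl⟩ := List.mem_map.1 hx
  exact Lit.eval_mem_Icc hI (hr.2.1 l hl)

/-- A residual implicator of a left-continuous t-norm takes the value `1` only when the
antecedent is at most the consequent. -/
theorem Tnorm.le_of_resid_eq_one {Tn : Tnorm} (hT : Tn.LeftContinuous) {x y : ℝ}
    (hx : x ∈ Set.Icc (0:ℝ) 1) (h : Tn.resid x y = 1) : x ≤ y := by
  have one_mem : (1:ℝ) ∈ Set.Icc (0:ℝ) 1 := ⟨zero_le_one, le_rfl⟩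
  have hT1 : Tn.T x 1 = x := by rw [Tn.comm x hx 1 one_mem, Tn.one_T x hx]
  have hne : {l | l ∈ Set.Icc (0:ℝ) 1 ∧ Tn.T x l ≤ y}.Nonempty := by
    by_contra hempty
    rw [Tnorm.resid, Set.not_nonempty_iff_eq_empty.1 hempty, Real.sSup_empty] at h
    exact zero_ne_one h
  have hlt : ∀ b ∈ Set.Ico (0:ℝ) 1, Tn.T x b ≤ y := by
    intro b hb
    obtain ⟨l, ⟨hl, hly⟩, hbl⟩ := exists_lt_of_lt_csSup hne (hb.2.trans_eq h.symm)
    exact (Tn.mono x hx x hx b ⟨hb.1, hb.2.le⟩ l hl le_rfl hbl.le).trans hly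
  have hcont : ContinuousWithinAt (fun t => Tn.T x t) (Set.Ico (0:ℝ) 1) 1 :=
    ((hT x hx 1 one_mem).1).mono Set.Ico_subset_Icc_self
  have hclosure : (1:ℝ) ∈ closure (Set.Ico (0:ℝ) 1) := by
    rw [closure_Ico zero_ne_one]
    exact one_mem
  rw [← hT1]
  exact hcont.closure_le hclosure continuousWithinAt_const hlt

theorem IsModel.evalBody_le {α : Type*} {P : Set (Rule α)} (hwf : ProgramWF P) {I : α → ℝ}
    (hI : IsInterp I) (hM : IsModel P I) {r : Rule α} (hr : r ∈ P) :
    r.evalBody I ≤ evalHead I r.head :=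
  Tnorm.le_of_resid_eq_one (hwf r hr).2.2.1 (Rule.evalBody_mem_Icc hI (hwf r hr)) (hM r hr)

/-- any answer set `A` of a FASP program `P` is a fixpoint of the
immediate consequence operator `Π_P`, i.e. `A(a) = sup { A(body(r)) | r ∈ P_a }`
for every atom `a`. -/
theorem answerSet_is_fixpoint {α : Type*} [Finite α]
    (P : Set (Rule α)) (hfin : P.Finite) (hwf : ProgramWF P)
    (A : α → ℝ) (hA : IsInterp A) (hAS : IsAnswerSet P A) :
    ∀ a : α, A a = sSup { x | ∃ r ∈ P, r.head = Sum.inl a ∧ x = r.evalBody A } := by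
  intro a
  have hub : ∀ x ∈ {x | ∃ r ∈ P, r.head = Sum.inl a ∧ x = r.evalBody A}, x ≤ A a := by
    rintro x ⟨r, hr, hhead, rfl⟩
    simpa only [hhead, evalHead] using hAS.1.evalBody_le hwf hA hr
  have hnonneg : 0 ≤ sSup {x | ∃ r ∈ P, r.head = Sum.inl a ∧ x = r.evalBody A} := by
    refine Real.sSup_nonneg ?_
    rintro x ⟨r, hr, -, rfl⟩
    exact (Rule.evalBody_mem_Icc hA (hwf r hr)).1
  refine le_antisymm ?_ (Real.sSup_le hub (hA a).1)
  by_contra! hlt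
  have hU : Unfounded P A {a} := by
    rintro u rfl r hr hhead
    exact Or.inr (Or.inl ((le_csSup ⟨A u, hub⟩ ⟨r, hr, hhead, rfl⟩).trans_lt hlt))
  have hmem : a ∈ supp A ∩ {a} := ⟨hnonneg.trans_lt hlt, rfl⟩
  rw [hAS.2 {a} hU] at hmem
  exact hmem
end

section
/- Let P be a FASP program and I an interpretation of P that is a model of the completion comp(P) but satisfies I ≠ lfp(Π_{P^I}). Then there exists a loop L of P with L ⊆ supp(I ⊖ lfp(Π_{P^I})) such that I does not satisfy the loop formula LF(L,P), i.e. max { I(l) | l ∈ L } > max { I(body(r)) | r ∈ R⁻(P,L) }. -/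
/-- In a finite set `U` all of whose vertices have a successor in `U`, some nonempty strongly
connected subset is closed under successors in `U`. -/
theorem exists_terminal_component {α : Type*} [Finite α] (R : α → α → Prop) {U : Set α}
    (hU : U.Nonempty) (hsucc : ∀ a ∈ U, ∃ b ∈ U, R a b) :
    ∃ L ⊆ U, L.Nonempty ∧
      (∀ a ∈ L, ∀ b ∈ L, Relation.TransGen (fun u v => R u v ∧ u ∈ L ∧ v ∈ L) a b) ∧
      ∀ a ∈ L, ∀ b ∈ U, R a b → b ∈ L := by
  let S : α → α → Prop := fun u v => R u v ∧ u ∈ U ∧ v ∈ U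
  let reach : α → Set α := fun a => {b | Relation.TransGen S a b}
  have hreach : ∀ a, reach a ⊆ U := by
    intro a b hab
    rcases Relation.TransGen.tail'_iff.1 hab with ⟨c, -, hc⟩
    exact hc.2.2
  obtain ⟨a₀, ha₀, hmin⟩ :=
    Set.exists_min_image U (fun a => (reach a).ncard) (Set.toFinite U) hU
  have heq : ∀ b ∈ reach a₀, reach b = reach a₀ := fun b hb =>
    Set.eq_of_subset_of_ncard_le (fun c hc => Relation.TransGen.trans hb hc)
      (hmin b (hreach a₀ hb)) (Set.toFinite _)
  refine ⟨reach a₀, hreach a₀, ?_, ?_, ?_⟩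
  · obtain ⟨b, hb, hab⟩ := hsucc a₀ ha₀
    exact ⟨b, .single ⟨hab, ha₀, hb⟩⟩
  · intro a ha b hb
    rw [← heq a ha] at hb
    induction hb with
    | single h => exact .single ⟨h.1, ha, Relation.TransGen.tail ha h⟩
    | tail hac h ih =>
      have hc := Relation.TransGen.trans ha hac
      exact .tail ih ⟨h.1, hc, Relation.TransGen.tail hc h⟩
  · intro a ha b hb hab
    exact Relation.TransGen.tail ha ⟨hab, hreach a₀ ha, hb⟩

/-- A rule body and its reduct with respect to `I` have the same value under `I` and `F`
respectively when `F` agrees with `I` on the positive body. -/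
theorem Rule.evalBody_reduct {α : Type*} {I F : α → ℝ} {r : Rule α}
    (h : ∀ b ∈ r.posbody, F b = I b) : (r.reduct I).evalBody F = r.evalBody I := by
  unfold Rule.evalBody Rule.reduct
  rw [List.map_map]
  congr 1
  refine List.map_congr_left fun l hl => ?_
  cases l with
  | pos b => exact h b hl
  | const c => rfl
  | neg n b => rfl

/-- The immediate consequence operators of `P` and of its reduct with respect to `I` agree at
`I`. -/
theorem PiOp_reduct_self {α : Type*} (P : Set (Rule α)) (I : α → ℝ) :
    PiOp (reduct P I) I = PiOp P I := by
  funext a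
  unfold PiOp
  congr 1
  ext x
  constructor
  · rintro ⟨_, ⟨r, hr, rfl⟩, hh, rfl⟩
    exact ⟨r, hr, hh, Rule.evalBody_reduct fun _ _ => rfl⟩
  · rintro ⟨r, hr, hh, rfl⟩
    exact ⟨r.reduct I, ⟨r, hr, rfl⟩, hh, (Rule.evalBody_reduct fun _ _ => rfl).symm⟩

/-- The bodies of the rules in a subset of a finite program take finitely many values. -/
theorem finite_evalBody {α : Type*} {P : Set (Rule α)} (hfin : P.Finite) (I : α → ℝ)
    (p : Rule α → Prop) : {x | ∃ r ∈ P, p r ∧ x = r.evalBody I}.Finite := by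
  refine (hfin.image (Rule.evalBody I)).subset ?_
  rintro x ⟨r, hr, -, rfl⟩
  exact ⟨r, hr, rfl⟩

/-- if `I` models the completion of `P` but `I ≠ lfp(Π_{P^I})`, then
there is a loop `L ⊆ supp(I ⊖ lfp(Π_{P^I}))` whose loop formula is violated by `I`,
i.e. `max { I(l) | l ∈ L } > max { I(body(r)) | r ∈ R⁻(P,L) }`. -/
theorem exists_violated_loop {α : Type*} [Finite α]
    (P : Set (Rule α)) (hfin : P.Finite) (hwf : ProgramWF P)
    (I : α → ℝ) (hI : IsInterp I) (hcomp : ModelsComp P I)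
    (F : α → ℝ) (hF : IsLfp (reduct P I) F) (hne : I ≠ F) :
    ∃ L ⊆ supp (fun a => max 0 (I a - F a)), IsLoop P L ∧
      sSup { x | ∃ r ∈ extRules P L, x = r.evalBody I } < sSup (I '' L) := by
  have hfix : PiOp P I = I := funext fun a => (hcomp.1 a).symm
  have hle : ∀ a, F a ≤ I a := hF.2.2 I hI ((PiOp_reduct_self P I).trans hfix)
  set U : Set α := supp (fun a => max 0 (I a - F a)) with hUdef
  have hmem : ∀ a, a ∈ U ↔ F a < I a := fun a => by simp [hUdef, supp]
  have hbody : ∀ r ∈ P, ∀ a, r.head = Sum.inl a → r.posbody ∩ U = ∅ → r.evalBody I ≤ F a := by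
    intro r hr a hh hdisj
    have hagree : ∀ b ∈ r.posbody, F b = I b := fun b hb =>
      (hle b).antisymm (not_lt.1 fun hlt => (hdisj ▸ ⟨hb, (hmem b).2 hlt⟩ : b ∈ (∅ : Set α)))
    rw [← Rule.evalBody_reduct hagree, ← congrFun hF.2.1 a]
    exact le_csSup (finite_evalBody (hfin.image _) F fun r => r.head = Sum.inl a).bddAbove
      ⟨r.reduct I, ⟨r, hr, rfl⟩, hh, rfl⟩
  have hUne : U.Nonempty := by
    obtain ⟨a, ha⟩ := Function.ne_iff.1 hne
    exact ⟨a, (hmem a).2 ((hle a).lt_of_ne' ha)⟩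
  have hpos : ∀ a ∈ U, 0 < I a := fun a ha => (hF.1 a).1.trans_lt ((hmem a).1 ha)
  have hsucc : ∀ a ∈ U, ∃ b ∈ U, depEdge P a b := by
    intro a ha
    have hne' : {x | ∃ r ∈ P, r.head = Sum.inl a ∧ x = r.evalBody I}.Nonempty := by
      rw [Set.nonempty_iff_ne_empty]
      intro h0
      have := hpos a ha
      rw [hcomp.1 a, h0, Real.sSup_empty] at this
      exact this.false
    obtain ⟨r, hr, hh, hval⟩ :=
      hne'.csSup_mem (finite_evalBody hfin I fun r => r.head = Sum.inl a)
    rw [← hcomp.1 a] at hval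
    have hmeet : (r.posbody ∩ U).Nonempty := by
      rw [Set.nonempty_iff_ne_empty]
      intro hdisj
      exact (hval ▸ hbody r hr a hh hdisj).not_gt ((hmem a).1 ha)
    obtain ⟨b, hb, hbU⟩ := hmeet
    exact ⟨b, hbU, r, hr, hh, hb⟩
  obtain ⟨L, hLU, hLne, hconn, hclosed⟩ := exists_terminal_component (depEdge P) hUne hsucc
  refine ⟨L, hLU, ⟨hLne, hconn⟩, ?_⟩
  have hsup : ∀ a ∈ L, I a ≤ sSup (I '' L) := fun a ha =>
    le_csSup (Set.toFinite _).bddAbove ⟨a, ha, rfl⟩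
  rcases Set.eq_empty_or_nonempty {x | ∃ r ∈ extRules P L, x = r.evalBody I} with h0 | hne'
  · obtain ⟨a, ha⟩ := hLne
    rw [h0, Real.sSup_empty]
    exact (hpos a (hLU ha)).trans_le (hsup a ha)
  · have hext : {x | ∃ r ∈ extRules P L, x = r.evalBody I}.Finite := by
      refine (hfin.image (Rule.evalBody I)).subset ?_
      rintro x ⟨r, hr, rfl⟩
      exact ⟨r, hr.1, rfl⟩
    obtain ⟨r, ⟨hr, ⟨a, ha, hh⟩, hdisj⟩, hval⟩ := hne'.csSup_mem hext
    rw [hval]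
    refine (hbody r hr a hh ?_).trans_lt (((hmem a).1 (hLU ha)).trans_le (hsup a ha))
    rw [Set.eq_empty_iff_forall_notMem] at hdisj ⊢
    exact fun b ⟨hb, hbU⟩ => hdisj b ⟨hb, hclosed a ha b hbU ⟨r, hr, hh, hb⟩⟩
end
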